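/- arXiv:2508.20360 — 4 statements merged into one kernel-verified Lean document; each statement's English description precedes it below -/
import Mathlib

section
/- For every integer k ≥ 1 there exists a constant C ≥ 0 (depending only on k) such that every permutation (a_1,…,a_n) of [n] contains an increasing-first k-modal subsequence of length L satisfying (L : ℝ) ≥ √(2·k·n) − C. -/
/-- `b : Fin m → ℤ` is an increasing-first `k`-modal sequence: it can be cut into at most
`k + 1` segments, alternately strictly increasing and strictly decreasing, starting with an
increasing segment (segments may be degenerate). Sequences of length at most 1 always qualify. -/
def IncFirstModal (k : ℕ) {m : ℕ} (b : Fin m → ℤ) : Prop :=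
  ∃ j : ℕ → ℕ, Monotone j ∧ j 0 = 0 ∧ m - 1 ≤ j (k + 1) ∧
    ∀ ℓ s, ℓ ≤ k → j ℓ ≤ s → s + 1 ≤ j (ℓ + 1) →
      ∀ (hs : s < m) (hs1 : s + 1 < m),
        if Even ℓ then b ⟨s, hs⟩ < b ⟨s + 1, hs1⟩ else b ⟨s + 1, hs1⟩ < b ⟨s, hs⟩

/-- `b : Fin m → ℤ` is a decreasing-first `k`-modal sequence: at most `k + 1` alternately
strictly decreasing and strictly increasing segments, starting with a decreasing segment. -/
def DecFirstModal (k : ℕ) {m : ℕ} (b : Fin m → ℤ) : Prop :=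
  ∃ j : ℕ → ℕ, Monotone j ∧ j 0 = 0 ∧ m - 1 ≤ j (k + 1) ∧
    ∀ ℓ s, ℓ ≤ k → j ℓ ≤ s → s + 1 ≤ j (ℓ + 1) →
      ∀ (hs : s < m) (hs1 : s + 1 < m),
        if Even ℓ then b ⟨s + 1, hs1⟩ < b ⟨s, hs⟩ else b ⟨s, hs⟩ < b ⟨s + 1, hs1⟩

/-- `a : Fin n → ℤ` is a permutation of `[n] = {1, …, n}`. -/
def IsPermOn (n : ℕ) (a : Fin n → ℤ) : Prop :=
  Function.Injective a ∧ ∀ i, 1 ≤ a i ∧ a i ≤ (n : ℤ)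

/-- The subsequence selected by the strictly monotone index map `s` ends at position `i`. -/
def EndsAt {n L : ℕ} (s : Fin L → Fin n) (i : Fin n) : Prop :=
  ∃ h : 0 < L, s ⟨L - 1, Nat.sub_lt h Nat.one_pos⟩ = i

/-- The subsequence selected by the strictly monotone index map `s` starts at position `i`. -/
def StartsAt {n L : ℕ} (s : Fin L → Fin n) (i : Fin n) : Prop :=
  ∃ h : 0 < L, s ⟨0, h⟩ = i

/-- Some increasing-first `ℓ`-modal subsequence of `a` of length `m + 1` ends at position `i`. -/
def HasModalEnding {n : ℕ} (a : Fin n → ℤ) (ℓ : ℕ) (i : Fin n) (m : ℕ) : Prop :=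
  ∃ s : Fin (m + 1) → Fin n, StrictMono s ∧ IncFirstModal ℓ (a ∘ s) ∧ s (Fin.last m) = i

namespace HasModalEnding

variable {n : ℕ} {a : Fin n → ℤ} {ℓ m : ℕ} {x y : Fin n}

theorem zero (a : Fin n → ℤ) (ℓ : ℕ) (i : Fin n) : HasModalEnding a ℓ i 0 :=
  ⟨fun _ => i, fun _ _ h => by omega,
    ⟨fun _ => 0, monotone_const, rfl, by simp, fun _ _ _ _ _ _ _ => by omega⟩, rfl⟩

theorem lt (h : HasModalEnding a ℓ x m) : m < n := by
  obtain ⟨s, hs, -, -⟩ := h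
  simpa using Fintype.card_le_of_injective s hs.injective

theorem succ_modality (h : HasModalEnding a ℓ x m) : HasModalEnding a (ℓ + 1) x m := by
  obtain ⟨s, hs, ⟨j, hj, hj0, hjm, hseg⟩, hx⟩ := h
  refine ⟨s, hs, ⟨j, hj, hj0, hjm.trans (hj (Nat.le_succ _)), fun r p hr hp hp1 hpm hpm1 => ?_⟩, hx⟩
  refine hseg r p ?_ hp hp1 hpm hpm1
  by_contra hlt
  obtain rfl : r = ℓ + 1 := by omega
  omega

theorem snoc (h : HasModalEnding a ℓ x m) (hxy : x < y)
    (ha : if Even ℓ then a x < a y else a y < a x) : HasModalEnding a ℓ y (m + 1) := by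
  obtain ⟨s, hs, ⟨j, hj, hj0, hjm, hseg⟩, rfl⟩ := h
  have hold (p : ℕ) (hp : p < m + 1) (hp' : p < m + 1 + 1) :
      (Fin.snoc s y : Fin (m + 1 + 1) → Fin n) ⟨p, hp'⟩ = s ⟨p, hp⟩ :=
    Fin.snoc_castSucc (α := fun _ => Fin n) y s ⟨p, hp⟩
  have hnew (hp' : m + 1 < m + 1 + 1) :
      (Fin.snoc s y : Fin (m + 1 + 1) → Fin n) ⟨m + 1, hp'⟩ = y :=
    Fin.snoc_last (α := fun _ => Fin n) y s
  refine ⟨Fin.snoc s y, ?_, ⟨fun r => if r ≤ ℓ then min (j r) m else m + 1, ?_, ?_, ?_, ?_⟩, ?_⟩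
  · refine Fin.strictMono_iff_lt_succ.2 fun p => ?_
    obtain ⟨p, hp⟩ := p
    rw [Fin.castSucc_mk, Fin.succ_mk, hold p hp]
    obtain hpm | rfl := Nat.lt_succ_iff_lt_or_eq.1 hp
    · rw [hold (p + 1) (by omega)]
      exact hs (by simp)
    · rw [hnew]
      exact hxy
  · intro p q hpq
    have := hj hpq
    dsimp only
    split_ifs <;> omega
  · simp [hj0]
  · simp
  · intro r p hr hp hp1 hpm hpm1
    simp only [hr, if_true] at hp
    dsimp only at hp1
    simp only [Function.comp_apply]
    rw [hold p (by omega)]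
    obtain hlt | rfl : p < m ∨ p = m := by omega
    · rw [hold (p + 1) (by omega)]
      refine hseg r p hr (by omega) ?_ (by omega) (by omega)
      obtain hrl | rfl := hr.lt_or_eq
      · rw [if_pos (by omega)] at hp1
        omega
      · omega
    · obtain hrl | rfl := hr.lt_or_eq
      · rw [if_pos (by omega)] at hp1
        omega
      · rw [hnew]
        exact ha
  · exact hnew _

end HasModalEnding

open Classical in
/-- One less than the maximal length of an increasing-first `ℓ`-modal subsequence of `a` ending at
position `i`. -/
noncomputable def modalRank {n : ℕ} (a : Fin n → ℤ) (ℓ : ℕ) (i : Fin n) : ℕ :=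
  Nat.findGreatest (HasModalEnding a ℓ i) n

section modalRank

variable {n : ℕ} {a : Fin n → ℤ} {ℓ : ℕ} {x y : Fin n}

theorem hasModalEnding_modalRank (a : Fin n → ℤ) (ℓ : ℕ) (i : Fin n) :
    HasModalEnding a ℓ i (modalRank a ℓ i) := by
  classical
  exact Nat.findGreatest_spec (Nat.zero_le n) (.zero a ℓ i)

theorem HasModalEnding.le_modalRank {m : ℕ} (h : HasModalEnding a ℓ x m) :
    m ≤ modalRank a ℓ x := by
  classical
  exact Nat.le_findGreatest h.lt.le h

theorem modalRank_le_succ (a : Fin n → ℤ) (ℓ : ℕ) (i : Fin n) :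
    modalRank a ℓ i ≤ modalRank a (ℓ + 1) i :=
  (hasModalEnding_modalRank a ℓ i).succ_modality.le_modalRank

theorem modalRank_lt (hxy : x < y) (ha : if Even ℓ then a x < a y else a y < a x) :
    modalRank a ℓ x < modalRank a ℓ y :=
  ((hasModalEnding_modalRank a ℓ x).snoc hxy ha).le_modalRank

theorem modalRank_pair_ne (hinj : Function.Injective a) (ℓ : ℕ) (hxy : x < y)
    (h : modalRank a ℓ x = modalRank a ℓ y) : modalRank a (ℓ + 1) x ≠ modalRank a (ℓ + 1) y := by
  have h0 : ¬ if Even ℓ then a x < a y else a y < a x := fun ha => (modalRank_lt hxy ha).ne h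
  refine (modalRank_lt hxy ?_).ne
  have hne : a x ≠ a y := hinj.ne hxy.ne
  by_cases hl : Even ℓ <;> simp only [Nat.even_add_one, hl, if_true, if_false, not_true,
    not_false_eq_true] at h0 ⊢ <;> omega

theorem modalRank_pair_injective (hinj : Function.Injective a) (ℓ : ℕ)
    (h : modalRank a ℓ x = modalRank a ℓ y)
    (h' : modalRank a (ℓ + 1) x = modalRank a (ℓ + 1) y) : x = y := by
  obtain hlt | heq | hgt := lt_trichotomy x y
  · exact (modalRank_pair_ne hinj ℓ hlt h h').elim
  · exact heq
  · exact (modalRank_pair_ne hinj ℓ hgt h.symm h'.symm).elim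

/-- If all ranks for modality `k` are below `t * k`, every position has some `ℓ < k` such that
its ranks for `ℓ` and `ℓ + 1` lie in the `ℓ`-th block of length `t`. -/
theorem exists_modalRank_block {k t : ℕ} (h : modalRank a k x < t * k) :
    ∃ ℓ < k, t * ℓ ≤ modalRank a ℓ x ∧ modalRank a (ℓ + 1) x < t * (ℓ + 1) := by
  by_contra! hcon
  have key : ∀ ℓ ≤ k, t * ℓ ≤ modalRank a ℓ x := by
    intro ℓ
    induction ℓ with
    | zero => simp
    | succ ℓ ih => exact fun hl => hcon ℓ hl (ih (by omega))
  exact (key k le_rfl).not_gt h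

theorem two_mul_le_of_modalRank_lt {k t : ℕ} (hinj : Function.Injective a)
    (h : ∀ i, modalRank a k i < t * k) : 2 * n ≤ k * (t * (t + 1)) := by
  choose b hbk hb hb' using fun i => exists_modalRank_block (h i)
  let T : Finset (ℕ × Σ _ : ℕ, ℕ) :=
    Finset.range k ×ˢ (Finset.range t).sigma fun q => Finset.range (q + 1)
  have hT : 2 * T.card = k * (t * (t + 1)) := by
    have hsum : ∀ u : ℕ, 2 * ∑ q ∈ Finset.range u, (q + 1) = u * (u + 1) := by
      intro u
      induction u with
      | zero => simp
      | succ u ih => rw [Finset.sum_range_succ, mul_add, ih]; ring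
    simp only [T, Finset.card_product, Finset.card_range, Finset.card_sigma]
    rw [mul_left_comm, hsum]
  let F : Fin n → ℕ × Σ _ : ℕ, ℕ := fun i =>
    (b i, ⟨modalRank a (b i + 1) i - t * b i, modalRank a (b i) i - t * b i⟩)
  have hF : ∀ i ∈ Finset.univ, F i ∈ T := by
    intro i _
    have h1 := hb i
    have h2 := hb' i
    have h3 := modalRank_le_succ a (b i) i
    rw [mul_add, mul_one] at h2
    simp only [F, T, Finset.mem_product, Finset.mem_sigma, Finset.mem_range]
    exact ⟨hbk i, by omega, by omega⟩
  have hFinj : Set.InjOn F (Finset.univ : Finset (Fin n)) := by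
    intro x _ y _ hxy
    simp only [F, Prod.mk.injEq, Sigma.mk.injEq, heq_eq_eq] at hxy
    obtain ⟨e, e1, e2⟩ := hxy
    have hx := hb x
    have hy := hb y
    have hx' := modalRank_le_succ a (b x) x
    have hy' := modalRank_le_succ a (b y) y
    rw [← e] at e1 e2 hy hy'
    exact modalRank_pair_injective hinj (b x) (by omega) (by omega)
  have hcard := Finset.card_le_card_of_injOn F hF hFinj
  rw [Finset.card_univ, Fintype.card_fin] at hcard
  omega

end modalRank

/-- For every integer `k ≥ 1` there is a constant `C ≥ 0` such that every permutation of `[n]`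
contains an increasing-first `k`-modal subsequence of length `L` with `(L : ℝ) ≥ √(2kn) - C`. -/
theorem stmt0 (k : ℕ) (hk : 1 ≤ k) :
    ∃ C : ℝ, 0 ≤ C ∧ ∀ (n : ℕ) (a : Fin n → ℤ), IsPermOn n a →
      ∃ (L : ℕ) (s : Fin L → Fin n), StrictMono s ∧ IncFirstModal k (a ∘ s) ∧
        (L : ℝ) ≥ Real.sqrt (2 * k * n) - C := by
  refine ⟨2 * k, by positivity, fun n a ha => ?_⟩
  obtain rfl | hn := n.eq_zero_or_pos
  · exact ⟨0, Fin.elim0, fun i => i.elim0,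
      ⟨fun _ => 0, monotone_const, rfl, by simp, fun _ _ _ _ _ hs => by omega⟩, by simp⟩
  have : Nonempty (Fin n) := ⟨⟨0, hn⟩⟩
  obtain ⟨i, hi⟩ := Finite.exists_max (modalRank a k)
  obtain ⟨s, hs, hmodal, -⟩ := hasModalEnding_modalRank a k i
  refine ⟨_, s, hs, hmodal, ?_⟩
  set m := modalRank a k i
  have hlt : m < (m / k + 1) * k := by
    rw [mul_comm]
    exact Nat.lt_mul_div_succ m hk
  have hle : m / k * k ≤ m := Nat.div_mul_le_self m k
  have hcount := two_mul_le_of_modalRank_lt (t := m / k + 1) ha.1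
    fun x => (hi x).trans_lt hlt
  have hsq : 2 * k * n ≤ (m + 1 + 2 * k) ^ 2 := by
    calc 2 * k * n = k * (2 * n) := by ring
      _ ≤ k * (k * ((m / k + 1) * (m / k + 1 + 1))) := Nat.mul_le_mul_left k hcount
      _ = (m / k * k + k) * (m / k * k + 2 * k) := by ring
      _ ≤ (m + 1 + 2 * k) * (m + 1 + 2 * k) := Nat.mul_le_mul (by omega) (by omega)
      _ = (m + 1 + 2 * k) ^ 2 := (sq _).symm
  rw [ge_iff_le, sub_le_iff_le_add]
  exact Real.sqrt_le_iff.2 ⟨by positivity, by exact_mod_cast hsq⟩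
end

section
/- For every integer k ≥ 1 there exists a constant C ≥ 0 (depending only on k) such that every permutation (a_1,…,a_n) of [n] contains a decreasing-first k-modal subsequence of length L satisfying (L : ℝ) ≥ √(2·k·n) − C. -/
/-- `ModalChain a t i m`: some decreasing-first `t`-modal subsequence of `a` of length `m`
ends at position `i`. -/
inductive ModalChain {n : ℕ} (a : Fin n → ℤ) : ℕ → Fin n → ℕ → Prop
  | single (t : ℕ) (i : Fin n) : ModalChain a t i 1
  | extend {t m : ℕ} {i j : Fin n} : ModalChain a t i m → i < j →
      (if Even t then a j < a i else a i < a j) → ModalChain a t j (m + 1)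
  | turn {t m : ℕ} {i : Fin n} : ModalChain a t i m → ModalChain a (t + 1) i m

theorem DecFirstModal.succ {t m : ℕ} {b : Fin m → ℤ} (h : DecFirstModal t b) :
    DecFirstModal (t + 1) b := by
  obtain ⟨j, hj, h0, hm, hb⟩ := h
  refine ⟨j, hj, h0, hm.trans (hj (by omega)), fun l s hl h1 h2 hs hs1 => ?_⟩
  rcases Nat.lt_or_ge t l with h | h
  · obtain rfl : l = t + 1 := by omega
    omega
  · exact hb l s h h1 h2 hs hs1

theorem DecFirstModal.snoc {t m : ℕ} {b : Fin (m + 1) → ℤ} {x : ℤ} (h : DecFirstModal t b)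
    (hx : if Even t then x < b (Fin.last m) else b (Fin.last m) < x) :
    DecFirstModal t (Fin.snoc b x : Fin (m + 2) → ℤ) := by
  obtain ⟨j, hj, h0, hm, hb⟩ := h
  refine ⟨fun l => if l ≤ t then min (j l) m else m + 1, ?_, ?_, ?_, ?_⟩
  · intro l l' hl
    have := hj hl
    dsimp only
    split_ifs <;> omega
  · simp [h0]
  · simp
  · intro l s hl h1 h2 hs hs1
    have hsm : s < m + 1 := by omega
    have e1 : (Fin.snoc b x : Fin (m + 2) → ℤ) ⟨s, hs⟩ = b ⟨s, hsm⟩ :=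
      Fin.snoc_castSucc (α := fun _ => ℤ) x b ⟨s, hsm⟩
    rcases Nat.lt_or_ge s m with h | h
    · have e2 : (Fin.snoc b x : Fin (m + 2) → ℤ) ⟨s + 1, hs1⟩ = b ⟨s + 1, by omega⟩ :=
        Fin.snoc_castSucc (α := fun _ => ℤ) x b ⟨s + 1, by omega⟩
      rw [e1, e2]
      have hjl : j (t + 1) ≥ m := by omega
      have hlt : l = t ∨ l + 1 ≤ t := by omega
      apply hb l s hl
      · simp only [hl, if_true] at h1
        omega
      · rcases hlt with rfl | hlt
        · omega
        · simp only [hlt, if_true] at h2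
          omega
    · obtain rfl : s = m := by omega
      have hlt : l = t := by
        by_contra hne
        have : l + 1 ≤ t := by omega
        simp only [this, if_true] at h2
        omega
      subst hlt
      have e2 : (Fin.snoc b x : Fin (s + 2) → ℤ) ⟨s + 1, hs1⟩ = x :=
        Fin.snoc_last (α := fun _ => ℤ) x b
      rw [e1, e2]
      exact hx

namespace ModalChain

variable {n : ℕ} {a : Fin n → ℤ}

theorem exists_subsequence {t m : ℕ} {i : Fin n} (h : ModalChain a t i m) :
    ∃ s : Fin m → Fin n, StrictMono s ∧ DecFirstModal t (a ∘ s) ∧ EndsAt s i := by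
  induction h with
  | single t i =>
    refine ⟨fun _ => i, Subsingleton.strictMono _, ⟨fun _ => 0, monotone_const, rfl, le_rfl, ?_⟩,
      Nat.one_pos, rfl⟩
    intro l s _ _ h
    omega
  | @extend t m i j _ hij hlt ih =>
    obtain ⟨s, hs, hd, hpos, he⟩ := ih
    obtain ⟨m, rfl⟩ : ∃ m', m = m' + 1 := ⟨m - 1, by omega⟩
    have he' : s (Fin.last m) = i := he
    refine ⟨Fin.snoc s j, ?_, ?_, Nat.succ_pos _, Fin.snoc_last (α := fun _ => Fin n) j s⟩
    · rw [Fin.strictMono_iff_lt_succ]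
      intro p
      induction p using Fin.lastCases with
      | last => simpa [he'] using hij
      | cast p =>
        rw [Fin.succ_castSucc, Fin.snoc_castSucc, Fin.snoc_castSucc]
        exact hs p.castSucc_lt_succ
    · rw [Fin.comp_snoc]
      refine hd.snoc ?_
      simpa [he'] using hlt
  | turn _ ih =>
    obtain ⟨s, hs, hd, he⟩ := ih
    exact ⟨s, hs, hd.succ, he⟩

theorem length_le {t m : ℕ} {i : Fin n} (h : ModalChain a t i m) : m ≤ n := by
  obtain ⟨s, hs, -⟩ := h.exists_subsequence
  simpa using Fintype.card_le_of_injective s hs.injective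

end ModalChain

open Classical in
/-- The maximal length of a decreasing-first `t`-modal subsequence of `a` ending at position `i`,
among those built by `ModalChain`. -/
noncomputable def maxChainLength {n : ℕ} (a : Fin n → ℤ) (t : ℕ) (i : Fin n) : ℕ :=
  Nat.findGreatest (ModalChain a t i) n

section maxChainLength

variable {n : ℕ} {a : Fin n → ℤ} {t : ℕ} {i j : Fin n}

theorem ModalChain.le_maxChainLength {m : ℕ} (h : ModalChain a t i m) :
    m ≤ maxChainLength a t i := by
  classical exact Nat.le_findGreatest h.length_le h

theorem one_le_maxChainLength : 1 ≤ maxChainLength a t i :=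
  (ModalChain.single t i).le_maxChainLength

theorem modalChain_maxChainLength : ModalChain a t i (maxChainLength a t i) := by
  classical exact Nat.findGreatest_spec (P := ModalChain a t i) (Fin.pos i) (.single t i)

theorem maxChainLength_le_succ : maxChainLength a t i ≤ maxChainLength a (t + 1) i :=
  modalChain_maxChainLength.turn.le_maxChainLength

theorem maxChainLength_lt (hij : i < j) (h : if Even t then a j < a i else a i < a j) :
    maxChainLength a t i < maxChainLength a t j :=
  (modalChain_maxChainLength.extend hij h).le_maxChainLength

theorem maxChainLength_pair_ne (ha : Function.Injective a) (hij : i < j)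
    (h₀ : maxChainLength a t i = maxChainLength a t j)
    (h₁ : maxChainLength a (t + 1) i = maxChainLength a (t + 1) j) : False := by
  have hne : a i ≠ a j := fun h => hij.ne (ha h)
  by_cases ht : Even t
  · rcases hne.lt_or_gt with h | h
    · exact (maxChainLength_lt (t := t + 1) hij (by simpa [Nat.even_add_one, ht] using h)).ne h₁
    · exact (maxChainLength_lt (t := t) hij (by simpa [ht] using h)).ne h₀
  · rcases hne.lt_or_gt with h | h
    · exact (maxChainLength_lt (t := t) hij (by simpa [ht] using h)).ne h₀
    · exact (maxChainLength_lt (t := t + 1) hij (by simpa [Nat.even_add_one, ht] using h)).ne h₁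

theorem maxChainLength_pair_injective (ha : Function.Injective a)
    (h₀ : maxChainLength a t i = maxChainLength a t j)
    (h₁ : maxChainLength a (t + 1) i = maxChainLength a (t + 1) j) : i = j := by
  rcases lt_trichotomy i j with h | h | h
  · exact (maxChainLength_pair_ne ha h h₀ h₁).elim
  · exact h
  · exact (maxChainLength_pair_ne ha h h₀.symm h₁.symm).elim

theorem card_filter_maxChainLength_le (ha : Function.Injective a) (t d c : ℕ) :
    (Finset.univ.filter fun i => d < maxChainLength a t i ∧ maxChainLength a (t + 1) i ≤ d + c).card
      ≤ c * (c + 1) / 2 := by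
  have hcard : ((Finset.range c).sigma fun y => Finset.range (y + 1)).card = c * (c + 1) / 2 := by
    have h := Finset.sum_range_succ' (fun y => y) c
    rw [Finset.sum_range_id, Nat.add_sub_cancel, add_zero, mul_comm] at h
    simp [Finset.card_sigma, h]
  rw [← hcard]
  refine Finset.card_le_card_of_injOn
    (fun i => ⟨maxChainLength a (t + 1) i - d - 1, maxChainLength a t i - d - 1⟩) ?_ ?_
  · intro i hi
    have hi' := (Finset.mem_filter.1 hi).2
    have := maxChainLength_le_succ (a := a) (t := t) (i := i)
    simp only [Finset.coe_sigma, Set.mem_sigma_iff, Finset.mem_coe, Finset.mem_range]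
    omega
  · intro i hi j hj hij
    have hi' := (Finset.mem_filter.1 hi).2
    have hj' := (Finset.mem_filter.1 hj).2
    have := maxChainLength_le_succ (a := a) (t := t) (i := i)
    have := maxChainLength_le_succ (a := a) (t := t) (i := j)
    simp only [Sigma.mk.injEq, heq_eq_eq] at hij
    exact maxChainLength_pair_injective ha (t := t) (by omega) (by omega)

theorem exists_maxChainLength_window {k c : ℕ} (h : maxChainLength a k i ≤ k * c) :
    ∃ t < k, t * c < maxChainLength a t i ∧ maxChainLength a (t + 1) i ≤ t * c + c := by
  by_contra! hcon
  have key : ∀ t ≤ k, t * c < maxChainLength a t i := by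
    intro t
    induction t with
    | zero => simpa using Nat.lt_of_succ_le one_le_maxChainLength
    | succ t ih =>
      intro ht
      rw [Nat.succ_mul]
      exact hcon t ht (ih (by omega))
  exact absurd (key k le_rfl) (by omega)

theorem card_le_of_maxChainLength_le {k c : ℕ} (ha : Function.Injective a)
    (h : ∀ i, maxChainLength a k i ≤ k * c) : n ≤ k * (c * (c + 1) / 2) := by
  have hsub : (Finset.univ : Finset (Fin n)) ⊆ (Finset.range k).biUnion fun t =>
      Finset.univ.filter fun i =>
        t * c < maxChainLength a t i ∧ maxChainLength a (t + 1) i ≤ t * c + c := by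
    intro i _
    obtain ⟨t, ht, hi⟩ := exists_maxChainLength_window (h i)
    exact Finset.mem_biUnion.2 ⟨t, Finset.mem_range.2 ht, by simpa using hi⟩
  have h₁ := Finset.card_le_card hsub
  have h₂ := Finset.card_biUnion_le_card_mul (Finset.range k) (fun t =>
    Finset.univ.filter fun i =>
      t * c < maxChainLength a t i ∧ maxChainLength a (t + 1) i ≤ t * c + c) _
    fun t _ => card_filter_maxChainLength_le ha t (t * c) c
  simpa using h₁.trans h₂

end maxChainLength

/-- For every integer `k ≥ 1` there is a constant `C ≥ 0` such that every permutation of `[n]`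
contains a decreasing-first `k`-modal subsequence of length `L` with `(L : ℝ) ≥ √(2kn) - C`. -/
theorem stmt5 (k : ℕ) (hk : 1 ≤ k) :
    ∃ C : ℝ, 0 ≤ C ∧ ∀ (n : ℕ) (a : Fin n → ℤ), IsPermOn n a →
      ∃ (L : ℕ) (s : Fin L → Fin n), StrictMono s ∧ DecFirstModal k (a ∘ s) ∧
        (L : ℝ) ≥ Real.sqrt (2 * k * n) - C := by
  refine ⟨2 * k, by positivity, fun n a ha => ?_⟩
  rcases Nat.eq_zero_or_pos n with rfl | hn
  · refine ⟨0, Fin.elim0, fun i => i.elim0,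
      ⟨fun _ => 0, monotone_const, rfl, le_rfl, fun _ _ _ _ _ hs => absurd hs (by omega)⟩, ?_⟩
    simp
  have : Nonempty (Fin n) := ⟨⟨0, hn⟩⟩
  obtain ⟨i, hi⟩ := Finite.exists_max (maxChainLength a k)
  obtain ⟨s, hs, hd, -⟩ := (modalChain_maxChainLength (a := a) (t := k) (i := i)).exists_subsequence
  refine ⟨maxChainLength a k i, s, hs, hd, ?_⟩
  set L := maxChainLength a k i
  set c := L / k + 1 with hc
  have hLc : L < k * c := Nat.lt_mul_div_succ L hk
  have hcL : k * c ≤ L + k := by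
    have := Nat.mul_div_le L k
    rw [hc, mul_add]
    omega
  have hcount := card_le_of_maxChainLength_le ha.1 fun j => (hi j).trans hLc.le
  have hcount' : 2 * n ≤ k * (c * (c + 1)) := by
    have := Nat.mul_le_mul_left k (Nat.mul_div_le (c * (c + 1)) 2)
    linarith
  have hreal : (2 * n : ℝ) ≤ k * (c * (c + 1)) := by exact_mod_cast hcount'
  have hcL' : (k * c : ℝ) ≤ L + k := by exact_mod_cast hcL
  have hsqrt : Real.sqrt (2 * k * n) ≤ k * c + k := by
    refine Real.sqrt_le_iff.2 ⟨by positivity, ?_⟩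
    have h₁ := mul_le_mul_of_nonneg_left hreal (Nat.cast_nonneg (α := ℝ) k)
    have h₂ : (0 : ℝ) ≤ k * k * (c + 1) := by positivity
    nlinarith
  linarith
end

section
/- For every permutation (a_1,…,a_n) of [n] with n ≥ 1 there exist a positive integer L with L(L+1) ≥ 2n and a position i ∈ [n] such that both an increasing-first 1-modal subsequence of length at least L and a decreasing-first 1-modal subsequence of length at least L end at position i. -/
/-- `ChainEnd R k i`: some `R`-chain with `k` terms ends at `i`. -/
inductive ChainEnd {α : Type*} (R : α → α → Prop) : ℕ → α → Prop
  | single (i : α) : ChainEnd R 1 i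
  | step {k : ℕ} {i j : α} : ChainEnd R k i → R i j → ChainEnd R (k + 1) j

/-- `a` increases from position `i` to the later position `j`. -/
def Ascends {n : ℕ} (a : Fin n → ℤ) (i j : Fin n) : Prop := i < j ∧ a i < a j

/-- `UnimodalEnd a k i`: some subsequence of `a` with `k` terms, first increasing and then
decreasing, ends at position `i`. -/
inductive UnimodalEnd {n : ℕ} (a : Fin n → ℤ) : ℕ → Fin n → Prop
  | of_chain {k : ℕ} {i : Fin n} : ChainEnd (Ascends a) k i → UnimodalEnd a k i
  | step {k : ℕ} {i j : Fin n} :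
      UnimodalEnd a k i → Ascends (-a) i j → UnimodalEnd a (k + 1) j

theorem ChainEnd.mono {α : Type*} {R S : α → α → Prop} (h : ∀ i j, R i j → S i j) {k : ℕ} {i : α}
    (hc : ChainEnd R k i) : ChainEnd S k i := by
  induction hc with
  | single i => exact .single i
  | step _ hR ih => exact ih.step (h _ _ hR)

theorem ChainEnd.le_succ {n : ℕ} {R : Fin n → Fin n → Prop} (h : ∀ i j, R i j → i < j) {k : ℕ}
    {i : Fin n} (hc : ChainEnd R k i) : k ≤ i.val + 1 := by
  induction hc with
  | single i => omega
  | step _ hR ih =>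
    have := Fin.lt_def.1 (h _ _ hR)
    omega

open Classical in
/-- The largest number of terms of an `R`-chain ending at `i`. -/
noncomputable def chainLength {n : ℕ} (R : Fin n → Fin n → Prop) (i : Fin n) : ℕ :=
  Nat.findGreatest (fun k => ChainEnd R k i) n

theorem chainEnd_chainLength {n : ℕ} (R : Fin n → Fin n → Prop) (i : Fin n) :
    ChainEnd R (chainLength R i) i := by
  classical
  exact Nat.findGreatest_spec (P := fun k => ChainEnd R k i) (m := 1)
    (by have := i.isLt; omega) (.single i)

theorem ChainEnd.le_chainLength {n : ℕ} {R : Fin n → Fin n → Prop} (h : ∀ i j, R i j → i < j)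
    {k : ℕ} {i : Fin n} (hc : ChainEnd R k i) : k ≤ chainLength R i := by
  classical
  exact Nat.le_findGreatest (by have := hc.le_succ h; have := i.isLt; omega) hc

theorem chainLength_pos {n : ℕ} {R : Fin n → Fin n → Prop} (h : ∀ i j, R i j → i < j)
    (i : Fin n) : 0 < chainLength R i :=
  (ChainEnd.single i).le_chainLength h

theorem chainLength_lt {n : ℕ} {R : Fin n → Fin n → Prop} (h : ∀ i j, R i j → i < j)
    {i j : Fin n} (hR : R i j) : chainLength R i < chainLength R j :=
  ((chainEnd_chainLength R i).step hR).le_chainLength h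

theorem Ascends.lt {n : ℕ} {a : Fin n → ℤ} (i j : Fin n) (h : Ascends a i j) : i < j := h.1

/-- `i` and the later position `j` lie in `A` and end equally long increasing subsequences. -/
def SameLevel {n : ℕ} (a : Fin n → ℤ) (A : Set (Fin n)) (i j : Fin n) : Prop :=
  i < j ∧ i ∈ A ∧ j ∈ A ∧ chainLength (Ascends a) i = chainLength (Ascends a) j

theorem SameLevel.lt {n : ℕ} {a : Fin n → ℤ} {A : Set (Fin n)} (i j : Fin n)
    (h : SameLevel a A i j) : i < j := h.1

theorem SameLevel.ascends_neg {n : ℕ} {a : Fin n → ℤ} (ha : Function.Injective a)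
    {A : Set (Fin n)} (i j : Fin n) (h : SameLevel a A i j) : Ascends (-a) i j := by
  refine ⟨h.1, ?_⟩
  rcases lt_trichotomy (a i) (a j) with hlt | heq | hgt
  · exact absurd h.2.2.2 (chainLength_lt Ascends.lt ⟨h.1, hlt⟩).ne
  · exact absurd (ha heq) h.1.ne
  · simpa using hgt

theorem unimodalEnd_of_sameLevel {n : ℕ} {a : Fin n → ℤ} (ha : Function.Injective a)
    {A : Set (Fin n)} {k : ℕ} {i : Fin n} (hc : ChainEnd (SameLevel a A) k i) :
    ∃ m, m + 1 = chainLength (Ascends a) i + k ∧ UnimodalEnd a m i := by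
  induction hc with
  | single i => exact ⟨_, rfl, .of_chain (chainEnd_chainLength _ i)⟩
  | step _ hR ih =>
    obtain ⟨m, hm, hu⟩ := ih
    refine ⟨m + 1, ?_, hu.step (SameLevel.ascends_neg ha _ _ hR)⟩
    have := hR.2.2.2
    omega

theorem chainLength_sameLevel_le {n : ℕ} {a : Fin n → ℤ} (ha : Function.Injective a)
    (A : Set (Fin n)) (i : Fin n) :
    chainLength (SameLevel a A) i ≤ chainLength (Ascends (-a)) i :=
  ((chainEnd_chainLength _ i).mono (SameLevel.ascends_neg ha)).le_chainLength Ascends.lt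

theorem eq_of_level_eq {n : ℕ} {a : Fin n → ℤ} {A : Set (Fin n)} {i j : Fin n} (hi : i ∈ A)
    (hj : j ∈ A) (h : chainLength (Ascends a) i = chainLength (Ascends a) j)
    (h' : chainLength (SameLevel a A) i = chainLength (SameLevel a A) j) : i = j := by
  rcases lt_trichotomy i j with hlt | heq | hgt
  · exact absurd h' (chainLength_lt SameLevel.lt ⟨hlt, hi, hj, h⟩).ne
  · exact heq
  · exact absurd h' (chainLength_lt SameLevel.lt ⟨hgt, hj, hi, h.symm⟩).ne'

theorem level_add_le {n L : ℕ} {a : Fin n → ℤ} (ha : Function.Injective a) {A : Set (Fin n)}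
    {i : Fin n} (hi : ¬ ∃ k, L ≤ k ∧ UnimodalEnd a k i) :
    chainLength (Ascends a) i + chainLength (SameLevel a A) i ≤ L := by
  obtain ⟨m, hm, hu⟩ := unimodalEnd_of_sameLevel ha (chainEnd_chainLength (SameLevel a A) i)
  by_contra hlt
  exact hi ⟨m, by omega, hu⟩

theorem two_mul_le_of_injective {n L : ℕ} (s t : Fin n → ℕ) (hs : ∀ i, 0 < s i)
    (ht : ∀ i, 0 < t i) (hst : ∀ i, s i + t i ≤ L)
    (hinj : ∀ i j, s i = s j → t i = t j → i = j) : 2 * n ≤ (L - 1) * L := by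
  have hcard : (Finset.univ : Finset (Fin n)).card ≤
      ((Finset.range L).sigma fun j => Finset.range j).card := by
    refine Finset.card_le_card_of_injOn (fun i => ⟨s i + t i - 1, t i - 1⟩) ?_ ?_
    · intro i _
      have := hs i; have := ht i; have := hst i
      simp only [Finset.coe_sigma, Finset.coe_range, Set.mem_sigma_iff, Set.mem_Iio]
      omega
    · intro i _ j _ hij
      have := hs i; have := ht i; have := hs j; have := ht j
      simp only [Sigma.mk.injEq, heq_eq_eq] at hij
      exact hinj i j (by omega) (by omega)
  rw [Finset.card_sigma, Finset.card_univ, Fintype.card_fin] at hcard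
  simp only [Finset.card_range] at hcard
  have := Finset.sum_range_id_mul_two L
  rw [mul_comm (L - 1)]
  omega

theorem two_mul_le_of_separated {n L : ℕ} {a : Fin n → ℤ} (ha : Function.Injective a)
    (A : Set (Fin n)) (hAB : ∀ p ∈ A, ∀ q ∈ Aᶜ, a q < a p)
    (hA : ∀ p ∈ A, ¬ ∃ k, L ≤ k ∧ UnimodalEnd a k p)
    (hB : ∀ q ∈ Aᶜ, ¬ ∃ k, L ≤ k ∧ UnimodalEnd (-a) k q) : 2 * n ≤ (L - 1) * L := by
  classical
  have hna : Function.Injective (-a) := fun i j h => ha (by simpa using h)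
  have hcross : ∀ p ∈ A, ∀ q ∈ Aᶜ,
      chainLength (Ascends a) p = chainLength (SameLevel (-a) Aᶜ) q →
      chainLength (SameLevel a A) p = chainLength (Ascends (-a)) q → False := by
    intro p hp q hq h1 h2
    have hlt := hAB p hp q hq
    rcases lt_trichotomy p q with h | h | h
    · have h3 : chainLength (Ascends (-a)) p < chainLength (Ascends (-a)) q :=
        chainLength_lt Ascends.lt ⟨h, by simpa using hlt⟩
      have h4 := chainLength_sameLevel_le ha A p
      omega
    · exact hq (h ▸ hp)
    · have h3 : chainLength (Ascends a) q < chainLength (Ascends a) p :=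
        chainLength_lt Ascends.lt ⟨h, hlt⟩
      have h4 := chainLength_sameLevel_le hna Aᶜ q
      rw [neg_neg] at h4
      omega
  refine two_mul_le_of_injective
    (fun i => if i ∈ A then chainLength (Ascends a) i else chainLength (SameLevel (-a) Aᶜ) i)
    (fun i => if i ∈ A then chainLength (SameLevel a A) i else chainLength (Ascends (-a)) i)
    ?_ ?_ ?_ ?_
  · intro i
    split_ifs
    exacts [chainLength_pos Ascends.lt i, chainLength_pos SameLevel.lt i]
  · intro i
    split_ifs
    exacts [chainLength_pos SameLevel.lt i, chainLength_pos Ascends.lt i]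
  · intro i
    split_ifs with hi
    · exact level_add_le ha (hA i hi)
    · rw [add_comm]
      exact level_add_le hna (hB i hi)
  · intro i j h1 h2
    by_cases hi : i ∈ A <;> by_cases hj : j ∈ A <;> simp only [hi, hj, if_true, if_false] at h1 h2
    · exact eq_of_level_eq hi hj h1 h2
    · exact (hcross i hi j hj h1 h2).elim
    · exact (hcross j hj i hi h1.symm h2.symm).elim
    · exact eq_of_level_eq (A := Aᶜ) hi hj h2 h1

theorem exists_unimodalEnd_both {n L : ℕ} {a : Fin n → ℤ} (ha : Function.Injective a)
    (hL : (L - 1) * L < 2 * n) :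
    ∃ i, (∃ k, L ≤ k ∧ UnimodalEnd a k i) ∧ ∃ k, L ≤ k ∧ UnimodalEnd (-a) k i := by
  by_contra! hno
  refine hL.not_ge (two_mul_le_of_separated ha
    {i | ∀ q, (∃ k, L ≤ k ∧ UnimodalEnd a k q) → a q < a i} ?_ ?_ ?_)
  · intro p hp q hq
    simp only [Set.mem_compl_iff, Set.mem_ofPred_eq, not_forall, not_lt] at hq
    obtain ⟨r, hr, hqr⟩ := hq
    exact hqr.trans_lt (hp r hr)
  · exact fun p hp h => lt_irrefl _ (hp p h)
  · rintro p hp ⟨k, hk, hd⟩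
    simp only [Set.mem_compl_iff, Set.mem_ofPred_eq, not_forall, not_lt] at hp
    obtain ⟨q, ⟨l, hl, hu⟩, hpq⟩ := hp
    rcases lt_trichotomy p q with h | h | h
    · refine hno q ⟨l, hl, hu⟩ (k + 1) (by omega) (hd.step ⟨h, ?_⟩)
      rw [neg_neg]
      exact hpq.lt_of_ne (ha.ne h.ne)
    · exact hno q ⟨l, hl, hu⟩ k hk (h ▸ hd)
    · refine hno p ⟨l + 1, by omega, hu.step ⟨h, ?_⟩⟩ k hk hd
      simpa using hpq.lt_of_ne (ha.ne h.ne')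

theorem ChainEnd.exists_seq {α : Type*} {R : α → α → Prop} {k : ℕ} {i : α}
    (hc : ChainEnd R k i) :
    ∃ s : ℕ → α, 0 < k ∧ s (k - 1) = i ∧ ∀ t, t + 1 < k → R (s t) (s (t + 1)) := by
  classical
  induction hc with
  | single i => exact ⟨fun _ => i, one_pos, rfl, fun t ht => by omega⟩
  | @step k i j _ hR ih =>
    obtain ⟨s, hk, hs, hstep⟩ := ih
    refine ⟨Function.update s k j, by omega, by simp, fun t ht => ?_⟩
    rw [Function.update_of_ne (by omega : t ≠ k)]
    rcases Nat.lt_succ_iff_lt_or_eq.1 ht with h | h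
    · rw [Function.update_of_ne h.ne]
      exact hstep t h
    · subst h
      rw [Nat.add_sub_cancel] at hs
      simpa [hs] using hR

theorem UnimodalEnd.exists_seq {n : ℕ} {a : Fin n → ℤ} {k : ℕ} {i : Fin n}
    (hu : UnimodalEnd a k i) :
    ∃ (s : ℕ → Fin n) (c : ℕ), 0 < k ∧ c < k ∧ s (k - 1) = i ∧
      (∀ t, t + 1 < k → t < c → Ascends a (s t) (s (t + 1))) ∧
      ∀ t, t + 1 < k → c ≤ t → Ascends (-a) (s t) (s (t + 1)) := by
  induction hu with
  | @of_chain k i hc =>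
    obtain ⟨s, hk, hs, hstep⟩ := hc.exists_seq
    exact ⟨s, k - 1, hk, by omega, hs, fun t ht _ => hstep t ht, fun t ht h => by omega⟩
  | @step k i j _ hR ih =>
    obtain ⟨s, c, hk, hc, hs, hup, hdown⟩ := ih
    refine ⟨Function.update s k j, c, by omega, by omega, by simp, fun t ht htc => ?_,
      fun t ht htc => ?_⟩
    · rw [Function.update_of_ne (by omega : t ≠ k), Function.update_of_ne (by omega : t + 1 ≠ k)]
      exact hup t (by omega) htc
    · rw [Function.update_of_ne (by omega : t ≠ k)]
      rcases Nat.lt_succ_iff_lt_or_eq.1 ht with h | h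
      · rw [Function.update_of_ne h.ne]
        exact hdown t h htc
      · subst h
        rw [Nat.add_sub_cancel] at hs
        simpa [hs] using hR

theorem UnimodalEnd.exists_incFirstModal {n : ℕ} {a : Fin n → ℤ} {k : ℕ} {i : Fin n}
    (hu : UnimodalEnd a k i) :
    ∃ s : Fin k → Fin n, StrictMono s ∧ IncFirstModal 1 (a ∘ s) ∧ EndsAt s i := by
  obtain ⟨s, c, hk, hc, hs, hup, hdown⟩ := hu.exists_seq
  refine ⟨fun t => s t, ?_, ⟨fun l => if l = 0 then 0 else if l = 1 then c else k, ?_, rfl, ?_, ?_⟩,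
    hk, hs⟩
  · obtain ⟨m, rfl⟩ := Nat.exists_eq_succ_of_ne_zero hk.ne'
    refine Fin.strictMono_iff_lt_succ.2 fun t => ?_
    have ht : (t : ℕ) + 1 < m + 1 := by omega
    rcases lt_or_ge (t : ℕ) c with h | h
    · exact (hup t ht h).1
    · exact (hdown t ht h).1
  · intro l l' h
    dsimp only
    split_ifs <;> omega
  · simp
  · intro l t hl h1 h2 ht ht1
    obtain rfl | rfl : l = 0 ∨ l = 1 := by omega
    · have h3 : t < c := by simpa using h2
      simpa using (hup t ht1 h3).2
    · have h3 : c ≤ t := by simpa using h1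
      simpa using (hdown t ht1 h3).2

theorem IncFirstModal.decFirstModal_of_neg {k m : ℕ} {b : Fin m → ℤ}
    (h : IncFirstModal k (-b)) : DecFirstModal k b := by
  simpa only [IncFirstModal, DecFirstModal, Pi.neg_apply, neg_lt_neg_iff] using h

/-- Every permutation of `[n]` (`n ≥ 1`) admits a positive integer `L` with `L(L+1) ≥ 2n` and a
position `i` at which both an increasing-first and a decreasing-first 1-modal subsequence of
length at least `L` end. -/
theorem stmt7 (n : ℕ) (hn : 1 ≤ n) (a : Fin n → ℤ) (ha : IsPermOn n a) :
    ∃ L : ℕ, 0 < L ∧ 2 * n ≤ L * (L + 1) ∧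
      ∃ i : Fin n,
        (∃ (L' : ℕ) (s : Fin L' → Fin n), L ≤ L' ∧ StrictMono s ∧
          IncFirstModal 1 (a ∘ s) ∧ EndsAt s i) ∧
        (∃ (L' : ℕ) (s : Fin L' → Fin n), L ≤ L' ∧ StrictMono s ∧
          DecFirstModal 1 (a ∘ s) ∧ EndsAt s i) := by
  have hex : ∃ L : ℕ, 2 * n ≤ L * (L + 1) := ⟨n, by nlinarith⟩
  obtain ⟨L, hL, hmin⟩ : ∃ L : ℕ, 2 * n ≤ L * (L + 1) ∧ ∀ m < L, ¬ 2 * n ≤ m * (m + 1) :=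
    ⟨Nat.find hex, Nat.find_spec hex, fun m => Nat.find_min hex⟩
  have hpos : 0 < L := by
    rcases Nat.eq_zero_or_pos L with rfl | h
    · omega
    · exact h
  have hlt := hmin (L - 1) (by omega)
  rw [Nat.sub_add_cancel hpos, not_le] at hlt
  obtain ⟨i, ⟨k, hk, hu⟩, l, hl, hd⟩ := exists_unimodalEnd_both ha.1 hlt
  obtain ⟨s, hs, hinc, hsi⟩ := hu.exists_incFirstModal
  obtain ⟨r, hr, hdec, hri⟩ := hd.exists_incFirstModal
  exact ⟨L, hpos, hL, i, ⟨k, s, hk, hs, hinc, hsi⟩,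
    l, r, hl, hr, hdec.decFirstModal_of_neg, hri⟩
end

section
/- For every integer k ≥ 0 there exists a constant C ≥ 0 (depending only on k) such that every permutation (a_1,…,a_n) of [n] contains a k-modal subsequence (increasing-first or decreasing-first) of length L satisfying (L : ℝ) ≥ √((2k+1)·n) − C. -/
/-- Two indices `i < j` with `a i < a j` when `d` is true and `a j < a i` when `d` is false. -/
def DirStep {n : ℕ} (a : Fin n → ℤ) (d : Bool) (i j : Fin n) : Prop :=
  i < j ∧ if d = true then a i < a j else a j < a i

/-- `IsModal a k d l`: the list of indices `l` selects a `k`-modal subsequence of `a` whose first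
monotone segment (possibly degenerate) is increasing if `d` is true, decreasing if `d` is false. -/
inductive IsModal {n : ℕ} (a : Fin n → ℤ) : ℕ → Bool → List (Fin n) → Prop
  | nil (k d) : IsModal a k d []
  | single (k d i) : IsModal a k d [i]
  | step {k d i j l} : DirStep a d i j → IsModal a k d (j :: l) → IsModal a k d (i :: j :: l)
  | turn {k d l} : IsModal a k (!d) l → IsModal a (k + 1) d l

namespace IsModal

variable {n : ℕ} {a : Fin n → ℤ}

theorem isChain_lt {k : ℕ} {d : Bool} {l : List (Fin n)} (h : IsModal a k d l) :
    l.IsChain (· < ·) := by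
  induction h with
  | nil k d => exact List.IsChain.nil
  | single k d i => exact List.IsChain.singleton i
  | step h _ ih => exact List.IsChain.cons_cons h.1 ih
  | turn _ ih => exact ih

theorem append_chain {k : ℕ} {d : Bool} {i : Fin n} {t : List (Fin n)}
    (h : IsModal a k d (i :: t)) (l : List (Fin n)) (hl : (l ++ [i]).IsChain (DirStep a d)) :
    IsModal a k d (l ++ i :: t) := by
  induction l with
  | nil => exact h
  | cons b l ih =>
    cases l with
    | nil =>
      simp only [List.cons_append, List.nil_append, List.isChain_cons_cons] at hl ⊢
      exact step hl.1 h
    | cons c l =>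
      simp only [List.cons_append, List.isChain_cons_cons] at hl ih ⊢
      exact step hl.1 (ih hl.2)

/-- The breakpoints `j` of a modal list of indices. -/
theorem exists_breakpoints {k : ℕ} {d : Bool} {l : List (Fin n)} (h : IsModal a k d l) :
    ∃ j : ℕ → ℕ, Monotone j ∧ j 0 = 0 ∧ l.length - 1 ≤ j (k + 1) ∧
      ∀ ℓ s, ℓ ≤ k → j ℓ ≤ s → s + 1 ≤ j (ℓ + 1) →
        ∀ (hs : s < l.length) (hs1 : s + 1 < l.length),
          if (Even ℓ ↔ d = true) then a l[s] < a l[s + 1] else a l[s + 1] < a l[s] := by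
  induction h with
  | nil k d => exact ⟨fun _ => 0, monotone_const, rfl, by simp, by simp⟩
  | single k d i => exact ⟨fun _ => 0, monotone_const, rfl, by simp, by simp⟩
  | @step k d i i' l h _ ih =>
    obtain ⟨j, hj, hj0, hjk, hjs⟩ := ih
    refine ⟨fun ℓ => if ℓ = 0 then 0 else j ℓ + 1, ?_, by simp, ?_, ?_⟩
    · intro x y hxy
      have := hj hxy
      dsimp only
      split_ifs <;> omega
    · simp only [List.length_cons] at hjk ⊢
      simp only [Nat.add_eq_zero_iff, one_ne_zero, and_false, if_false]
      omega
    · intro ℓ s hℓ h1 h2 hs hs1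
      simp only [Nat.add_eq_zero_iff, one_ne_zero, and_false, if_false] at h2
      cases s with
      | zero =>
        have : ℓ = 0 := by
          by_contra hne
          simp [hne] at h1
        subst this
        have := h.2
        simpa using this
      | succ s =>
        have h3 : j ℓ ≤ s := by
          dsimp only at h1
          split_ifs at h1 with h0
          · subst h0; omega
          · omega
        exact hjs ℓ s hℓ h3 (by omega) (by simpa using hs) (by simpa using hs1)
  | @turn k d l _ ih =>
    obtain ⟨j, hj, hj0, hjk, hjs⟩ := ih
    refine ⟨fun ℓ => j (ℓ - 1), ?_, by simpa using hj0, by simpa using hjk, ?_⟩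
    · intro x y hxy
      exact hj (Nat.sub_le_sub_right hxy 1)
    · intro ℓ s hℓ h1 h2 hs hs1
      cases ℓ with
      | zero =>
        simp [hj0] at h2
      | succ ℓ =>
        have := hjs ℓ s (by omega) (by simpa using h1) (by simpa using h2) hs hs1
        have e : (Even (ℓ + 1) ↔ d = true) ↔ (Even ℓ ↔ (!d) = true) := by
          rw [Nat.even_add_one]
          cases d <;> simp
        simpa only [e] using this

theorem exists_subsequence {k : ℕ} {d : Bool} {l : List (Fin n)} (h : IsModal a k d l) :
    ∃ s : Fin l.length → Fin n, StrictMono s ∧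
      (IncFirstModal k (a ∘ s) ∨ DecFirstModal k (a ∘ s)) := by
  refine ⟨l.get, List.sortedLT_iff_strictMono_get.1 (List.sortedLT_iff_isChain.2 h.isChain_lt), ?_⟩
  obtain ⟨j, hj, hj0, hjk, hjs⟩ := h.exists_breakpoints
  cases d with
  | true =>
    refine Or.inl ⟨j, hj, hj0, hjk, fun ℓ s h1 h2 h3 hs hs1 => ?_⟩
    simpa using hjs ℓ s h1 h2 h3 hs hs1
  | false =>
    refine Or.inr ⟨j, hj, hj0, hjk, fun ℓ s h1 h2 h3 hs hs1 => ?_⟩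
    have := hjs ℓ s h1 h2 h3 hs hs1
    by_cases he : Even ℓ <;> simpa [he] using this

end IsModal

section Potentials

variable {ι : Type*} [LinearOrder ι] {S : Finset ι} {f g F G : ι → ℕ}

theorem eq_of_potentials_eq
    (h : ∀ i ∈ S, ∀ j ∈ S, i < j → f i < f j ∨ g i < g j)
    {i j : ι} (hi : i ∈ S) (hj : j ∈ S) (hf : f i = f j) (hg : g i = g j) : i = j := by
  rcases lt_trichotomy i j with hij | hij | hij
  · have := h i hi j hj hij
    omega
  · exact hij
  · have := h j hj i hi hij
    omega

theorem card_le_mul_of_potentials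
    (h : ∀ i ∈ S, ∀ j ∈ S, i < j → f i < f j ∨ g i < g j) {b c u v : ℕ}
    (hf : ∀ i ∈ S, b ≤ f i ∧ f i < b + u) (hg : ∀ i ∈ S, c ≤ g i ∧ g i < c + v) :
    S.card ≤ u * v := by
  have : S.card ≤ (Finset.Ico b (b + u) ×ˢ Finset.Ico c (c + v)).card := by
    refine Finset.card_le_card_of_injOn (fun i => (f i, g i)) ?_ ?_
    · intro i hi
      simpa using ⟨hf i hi, hg i hi⟩
    · intro i hi j hj hij
      simp only [Prod.mk.injEq] at hij
      exact eq_of_potentials_eq h hi hj hij.1 hij.2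
  simpa using this

theorem card_triangle_of_potentials
    (h : ∀ i ∈ S, ∀ j ∈ S, i < j → f i < f j ∨ g i < g j) {p r : ℕ}
    (hS : ∀ i ∈ S, p ≤ f i ∧ f i ≤ g i ∧ g i < p + r) :
    S.card * 2 ≤ r * (r + 1) := by
  have h1 : S.card ≤ ((Finset.range r).sigma fun v => Finset.range (v + 1)).card := by
    refine Finset.card_le_card_of_injOn (fun i => ⟨g i - p, f i - p⟩) ?_ ?_
    · intro i hi
      have := hS i hi
      simp only [Finset.coe_sigma, Set.mem_sigma_iff, Finset.coe_range, Set.mem_Iio]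
      omega
    · intro i hi j hj hij
      have h2 := hS i hi
      have h3 := hS j hj
      simp only [Sigma.mk.injEq, heq_eq_eq] at hij
      exact eq_of_potentials_eq h hi hj (by omega) (by omega)
  rw [Finset.card_sigma] at h1
  simp only [Finset.card_range] at h1
  have h2 : (∑ v ∈ Finset.range r, (v + 1)) * 2 = r * (r + 1) := by
    have := Finset.sum_range_id_mul_two (r + 1)
    rw [Finset.sum_range_succ'] at this
    simpa [mul_comm] using this
  omega

/-- The points escaping a rectangle, two triangles and an upper quadrant are of two mutually
exclusive kinds, so that the thresholds can be balanced to leave almost no point uncovered. -/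
theorem exists_thresholds
    (h : ∀ i ∈ S, ∀ j ∈ S, i < j → (f i < f j ∧ F i < F j) ∨ (g i < g j ∧ G i < G j))
    (hfG : ∀ i ∈ S, f i ≤ G i) (hgF : ∀ i ∈ S, g i ≤ F i) (r : ℕ) :
    ∃ P Q : ℕ, P + Q = 4 * r ∧
      S.card ≤ 2 * r ^ 2 + 7 * r + 2 + (S.filter fun i => P ≤ F i ∧ Q ≤ G i).card := by
  classical
  set E : ℕ → Finset ι := fun p =>
    S.filter fun i => p ≤ f i ∧ F i + p < 3 * r ∧ g i + p < 2 * r ∧ p + r ≤ G i with hE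
  set E' : ℕ → Finset ι := fun p =>
    S.filter fun i => f i < p ∧ 3 * r ≤ F i + p ∧ 2 * r ≤ g i + p ∧ G i < p + r with hE'
  have hfg : ∀ T ⊆ S, ∀ i ∈ T, ∀ j ∈ T, i < j → f i < f j ∨ g i < g j := fun T hT i hi j hj hij =>
    (h i (hT hi) j (hT hj) hij).imp And.left And.left
  have hfG' : ∀ T ⊆ S, ∀ i ∈ T, ∀ j ∈ T, i < j → f i < f j ∨ G i < G j := fun T hT i hi j hj hij =>
    (h i (hT hi) j (hT hj) hij).imp And.left And.right
  have hgF' : ∀ T ⊆ S, ∀ i ∈ T, ∀ j ∈ T, i < j → g i < g j ∨ F i < F j := fun T hT i hi j hj hij =>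
    (h i (hT hi) j (hT hj) hij).symm.imp And.left And.right
  have hexcl : ∀ p, E p = ∅ ∨ E' p = ∅ := by
    intro p
    by_contra! hne
    obtain ⟨⟨i, hi⟩, ⟨j, hj⟩⟩ := hne
    simp only [hE, hE', Finset.mem_filter] at hi hj
    rcases lt_trichotomy i j with hij | hij | hij
    · have := h i hi.1 j hj.1 hij
      omega
    · subst hij
      omega
    · have := h j hj.1 i hi.1 hij
      omega
  have hex : ∃ p, E p = ∅ :=
    ⟨2 * r, Finset.filter_eq_empty_iff.2 fun i _ => by omega⟩
  obtain ⟨p, hp, hmin⟩ : ∃ p, E p = ∅ ∧ ∀ m < p, E m ≠ ∅ :=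
    ⟨Nat.find hex, Nat.find_spec hex, fun m hm => Nat.find_min hex hm⟩
  have hp2 : p ≤ 2 * r := by
    by_contra hlt
    exact hmin (2 * r) (by omega) (Finset.filter_eq_empty_iff.2 fun i _ => by omega)
  obtain ⟨q, hq⟩ : ∃ q, p + q = 2 * r := ⟨2 * r - p, by omega⟩
  have hE'card : (E' p).card ≤ 6 * r + 2 := by
    rcases Nat.eq_zero_or_pos p with hp0 | hp0
    · have : E' p = ∅ := Finset.filter_eq_empty_iff.2 fun i _ => by omega
      simp [this]
    · have hprev : E' (p - 1) = ∅ := (hexcl (p - 1)).resolve_left (hmin (p - 1) (by omega))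
      rw [Finset.filter_eq_empty_iff] at hprev
      have hsub : E' p ⊆ ((S.filter fun i => f i < p ∧ g i = q) ∪
          (S.filter fun i => f i < p ∧ G i = p + r - 1)) ∪
          ((S.filter fun i => f i = p - 1 ∧ G i < p + r) ∪
          (S.filter fun i => q ≤ g i ∧ F i = q + r)) := by
        intro i hi
        simp only [hE', Finset.mem_filter] at hi
        have := hprev hi.1
        simp only [Finset.mem_union, Finset.mem_filter, hi.1, true_and]
        omega
      have h1 : (S.filter fun i => f i < p ∧ g i = q).card ≤ p * 1 :=
        card_le_mul_of_potentials (b := 0) (c := q) (hfg _ (Finset.filter_subset _ _))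
          (fun i hi => by simp only [Finset.mem_filter] at hi; omega)
          (fun i hi => by simp only [Finset.mem_filter] at hi; omega)
      have h2 : (S.filter fun i => f i < p ∧ G i = p + r - 1).card ≤ p * 1 :=
        card_le_mul_of_potentials (b := 0) (c := p + r - 1) (hfG' _ (Finset.filter_subset _ _))
          (fun i hi => by simp only [Finset.mem_filter] at hi; omega)
          (fun i hi => by simp only [Finset.mem_filter] at hi; omega)
      have h3 : (S.filter fun i => f i = p - 1 ∧ G i < p + r).card ≤ 1 * (r + 1) :=
        card_le_mul_of_potentials (b := p - 1) (c := p - 1) (hfG' _ (Finset.filter_subset _ _))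
          (fun i hi => by simp only [Finset.mem_filter] at hi; omega)
          (fun i hi => by
            simp only [Finset.mem_filter] at hi
            have := hfG i hi.1
            omega)
      have h4 : (S.filter fun i => q ≤ g i ∧ F i = q + r).card ≤ (r + 1) * 1 :=
        card_le_mul_of_potentials (b := q) (c := q + r) (hgF' _ (Finset.filter_subset _ _))
          (fun i hi => by
            simp only [Finset.mem_filter] at hi
            have := hgF i hi.1
            omega)
          (fun i hi => by simp only [Finset.mem_filter] at hi; omega)
      have := (Finset.card_le_card hsub).trans ((Finset.card_union_le _ _).trans
        (add_le_add (Finset.card_union_le _ _) (Finset.card_union_le _ _)))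
      omega
  refine ⟨q + r, p + r, by omega, ?_⟩
  have hcover : S ⊆ (((S.filter fun i => f i < p ∧ g i < q) ∪ E' p) ∪
      ((S.filter fun i => p ≤ f i ∧ G i < p + r) ∪ (S.filter fun i => q ≤ g i ∧ F i < q + r))) ∪
      (S.filter fun i => q + r ≤ F i ∧ p + r ≤ G i) := by
    intro i hi
    have hnot := Finset.filter_eq_empty_iff.1 hp hi
    simp only [hE', Finset.mem_union, Finset.mem_filter, hi, true_and]
    omega
  have h1 : (S.filter fun i => f i < p ∧ g i < q).card ≤ p * q :=
    card_le_mul_of_potentials (b := 0) (c := 0) (hfg _ (Finset.filter_subset _ _))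
      (fun i hi => by simp only [Finset.mem_filter] at hi; omega)
      (fun i hi => by simp only [Finset.mem_filter] at hi; omega)
  have h2 : (S.filter fun i => p ≤ f i ∧ G i < p + r).card * 2 ≤ r * (r + 1) :=
    card_triangle_of_potentials (p := p) (hfG' _ (Finset.filter_subset _ _)) fun i hi => by
      simp only [Finset.mem_filter] at hi
      exact ⟨hi.2.1, hfG i hi.1, hi.2.2⟩
  have h3 : (S.filter fun i => q ≤ g i ∧ F i < q + r).card * 2 ≤ r * (r + 1) :=
    card_triangle_of_potentials (p := q) (hgF' _ (Finset.filter_subset _ _)) fun i hi => by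
      simp only [Finset.mem_filter] at hi
      exact ⟨hi.2.1, hgF i hi.1, hi.2.2⟩
  have h4 : p * q ≤ r ^ 2 := by
    have : (p + q) ^ 2 = 4 * r ^ 2 := by rw [hq]; ring
    linarith [four_mul_le_sq_add p q]
  have h5 := (Finset.card_le_card hcover).trans ((Finset.card_union_le _ _).trans
    (Nat.add_le_add_right ((Finset.card_union_le _ _).trans
      (add_le_add (Finset.card_union_le _ _) (Finset.card_union_le _ _))) _))
  nlinarith

end Potentials

section Lengths

variable {n : ℕ} {a : Fin n → ℤ} {S : Finset (Fin n)}

theorem dirStep_or (ha : Function.Injective a) {i j : Fin n} (hij : i < j) :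
    DirStep a true i j ∨ DirStep a false i j := by
  rcases lt_or_gt_of_ne (ha.ne hij.ne) with h | h
  · exact Or.inl ⟨hij, by simpa using h⟩
  · exact Or.inr ⟨hij, by simpa using h⟩

/-- The number of elements before the end of a longest monotone chain in `S` ending at `i`. -/
theorem exists_chain_potential {k A : ℕ} {d : Bool}
    (hA : ∀ l, (∀ x ∈ l, x ∈ S) → IsModal a k d l → l.length ≤ A) :
    ∃ f : Fin n → ℕ,
      (∀ i ∈ S, ∃ l : List (Fin n), l.length = f i ∧ (∀ x ∈ l, x ∈ S) ∧
        (l ++ [i]).IsChain (DirStep a d)) ∧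
      ∀ i ∈ S, ∀ j ∈ S, DirStep a d i j → f i < f j := by
  classical
  set p : Fin n → ℕ → Prop := fun i m => ∃ l : List (Fin n), l.length = m ∧ (∀ x ∈ l, x ∈ S) ∧
    (l ++ [i]).IsChain (DirStep a d) with hp
  have hspec : ∀ i, p i (Nat.findGreatest (p i) A) := fun i =>
    Nat.findGreatest_spec (m := 0) (Nat.zero_le _) ⟨[], by simp⟩
  refine ⟨fun i => Nat.findGreatest (p i) A, fun i _ => hspec i, fun i hi j hj hij => ?_⟩
  obtain ⟨l, hl, hlS, hlc⟩ := hspec i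
  have hc : ((l ++ [i]) ++ [j]).IsChain (DirStep a d) := by
    rw [List.isChain_append]
    refine ⟨hlc, List.IsChain.singleton j, ?_⟩
    simpa using hij
  have hS' : ∀ x ∈ l ++ [i], x ∈ S := by
    intro x hx
    rcases List.mem_append.1 hx with hx | hx
    · exact hlS x hx
    · rw [List.mem_singleton.1 hx]; exact hi
  have hlen := hA ((l ++ [i]) ++ [j])
    (by
      intro x hx
      rcases List.mem_append.1 hx with hx | hx
      · exact hS' x hx
      · rw [List.mem_singleton.1 hx]; exact hj)
    (IsModal.append_chain (IsModal.single k d j) (l ++ [i]) hc)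
  simp only [List.length_append, List.length_singleton] at hlen
  have : l.length + 1 ≤ Nat.findGreatest (p j) A :=
    Nat.le_findGreatest (by omega) ⟨l ++ [i], by simp, hS', hc⟩
  dsimp only
  omega

/-- The length of a longest `k`-modal list of elements of `S` starting at `i`. -/
theorem exists_start_potential {k A : ℕ} {d : Bool}
    (hA : ∀ l, (∀ x ∈ l, x ∈ S) → IsModal a k d l → l.length ≤ A) :
    ∃ X : Fin n → ℕ,
      (∀ i ∈ S, ∃ t : List (Fin n), t.length + 1 = X i ∧ (∀ x ∈ t, x ∈ S) ∧
        IsModal a k d (i :: t)) ∧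
      (∀ i ∈ S, ∀ t : List (Fin n), (∀ x ∈ t, x ∈ S) → IsModal a k d (i :: t) →
        t.length + 1 ≤ X i) ∧
      ∀ i ∈ S, ∀ j ∈ S, DirStep a d i j → X j < X i := by
  classical
  set p : Fin n → ℕ → Prop := fun i m => ∃ t : List (Fin n), t.length = m ∧ (∀ x ∈ t, x ∈ S) ∧
    IsModal a k d (i :: t) with hp
  have hspec : ∀ i, p i (Nat.findGreatest (p i) A) := fun i =>
    Nat.findGreatest_spec (m := 0) (Nat.zero_le _) ⟨[], rfl, by simp, IsModal.single k d i⟩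
  have hmax : ∀ i ∈ S, ∀ t : List (Fin n), (∀ x ∈ t, x ∈ S) → IsModal a k d (i :: t) →
      t.length ≤ Nat.findGreatest (p i) A := by
    intro i hi t ht hm
    have := hA (i :: t) (by simpa using ⟨hi, ht⟩) hm
    simp only [List.length_cons] at this
    exact Nat.le_findGreatest (by omega) ⟨t, rfl, ht, hm⟩
  refine ⟨fun i => Nat.findGreatest (p i) A + 1, fun i _ => ?_, fun i hi t ht hm => ?_,
    fun i hi j hj hij => ?_⟩
  · obtain ⟨t, h1, h2⟩ := hspec i
    exact ⟨t, by rw [h1], h2⟩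
  · exact Nat.add_le_add_right (hmax i hi t ht hm) 1
  · obtain ⟨t, h1, h2, h3⟩ := hspec j
    have := hmax i hi (j :: t) (by simpa using ⟨hj, h2⟩) (IsModal.step hij h3)
    simp only [List.length_cons] at this
    dsimp only
    omega

theorem length_add_start_le {k A : ℕ} {d : Bool}
    (hA : ∀ l, (∀ x ∈ l, x ∈ S) → IsModal a (k + 1) d l → l.length ≤ A)
    {i : Fin n} (hi : i ∈ S) {l t : List (Fin n)} (hl : ∀ x ∈ l, x ∈ S)
    (hc : (l ++ [i]).IsChain (DirStep a d)) (ht : ∀ x ∈ t, x ∈ S)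
    (hm : IsModal a k (!d) (i :: t)) : l.length + (t.length + 1) ≤ A := by
  have := hA (l ++ i :: t)
    (by
      intro x hx
      simp only [List.mem_append, List.mem_cons] at hx
      rcases hx with hx | rfl | hx
      exacts [hl x hx, hi, ht x hx])
    (IsModal.append_chain (IsModal.turn hm) l hc)
  simpa using this

theorem card_le_of_length_le (ha : Function.Injective a) {A B : ℕ}
    (hA : ∀ l, (∀ x ∈ l, x ∈ S) → IsModal a 0 true l → l.length ≤ A)
    (hB : ∀ l, (∀ x ∈ l, x ∈ S) → IsModal a 0 false l → l.length ≤ B) :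
    S.card ≤ A * B := by
  obtain ⟨f, hf, hf'⟩ := exists_chain_potential hA
  obtain ⟨g, hg, hg'⟩ := exists_chain_potential hB
  have key : ∀ {d : Bool} {C : ℕ},
      (∀ l, (∀ x ∈ l, x ∈ S) → IsModal a 0 d l → l.length ≤ C) → ∀ i ∈ S, ∀ l : List (Fin n),
      (∀ x ∈ l, x ∈ S) → (l ++ [i]).IsChain (DirStep a d) → l.length < C := by
    intro d C hC i hi l hl hc
    have := hC (l ++ [i])
      (by
        intro x hx
        simp only [List.mem_append, List.mem_singleton] at hx
        rcases hx with hx | rfl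
        exacts [hl x hx, hi])
      (IsModal.append_chain (IsModal.single 0 d i) l hc)
    simpa using this
  refine card_le_mul_of_potentials (f := f) (g := g) (b := 0) (c := 0) ?_ ?_ ?_
  · intro i hi j hj hij
    exact (dirStep_or ha hij).imp (hf' i hi j hj) (hg' i hi j hj)
  · intro i hi
    obtain ⟨l, h1, h2, h3⟩ := hf i hi
    have := key hA i hi l h2 h3
    omega
  · intro i hi
    obtain ⟨l, h1, h2, h3⟩ := hg i hi
    have := key hB i hi l h2 h3
    omega

/-- Passing from `k + 1` to `k` turns: up to `2 * r ^ 2 + O(r)` points, `S` is a set in which the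
sum of the longest `k`-modal lengths of the two kinds is smaller by `4 * r`. -/
theorem exists_reduced_subset (ha : Function.Injective a) {k A B : ℕ}
    (hA : ∀ l, (∀ x ∈ l, x ∈ S) → IsModal a (k + 1) true l → l.length ≤ A)
    (hB : ∀ l, (∀ x ∈ l, x ∈ S) → IsModal a (k + 1) false l → l.length ≤ B) (r : ℕ) :
    ∃ T ⊆ S, S.card ≤ 2 * r ^ 2 + 7 * r + 2 + T.card ∧
      (T = ∅ ∨ ∃ A' B' : ℕ, A' + B' + 4 * r = A + B ∧
        (∀ l, (∀ x ∈ l, x ∈ T) → IsModal a k true l → l.length ≤ A') ∧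
        (∀ l, (∀ x ∈ l, x ∈ T) → IsModal a k false l → l.length ≤ B')) := by
  obtain ⟨f, hf, hf'⟩ := exists_chain_potential hA
  obtain ⟨g, hg, hg'⟩ := exists_chain_potential hB
  obtain ⟨X, hX, hXmax, hX'⟩ := exists_start_potential (k := k) (d := true)
    fun l hl hm => hB l hl (IsModal.turn hm)
  obtain ⟨Y, hY, hYmax, hY'⟩ := exists_start_potential (k := k) (d := false)
    fun l hl hm => hA l hl (IsModal.turn hm)
  have hfY : ∀ i ∈ S, f i + Y i ≤ A ∧ 1 ≤ Y i := by
    intro i hi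
    obtain ⟨l, h1, h2, h3⟩ := hf i hi
    obtain ⟨t, h4, h5, h6⟩ := hY i hi
    have := length_add_start_le hA hi h2 h3 h5 h6
    omega
  have hgX : ∀ i ∈ S, g i + X i ≤ B ∧ 1 ≤ X i := by
    intro i hi
    obtain ⟨l, h1, h2, h3⟩ := hg i hi
    obtain ⟨t, h4, h5, h6⟩ := hX i hi
    have := length_add_start_le hB hi h2 h3 h5 h6
    omega
  obtain ⟨P, Q, hPQ, hcard⟩ := exists_thresholds (S := S) (f := f) (g := g)
    (F := fun i => B - X i) (G := fun i => A - Y i)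
    (by
      intro i hi j hj hij
      have h1 := hfY i hi
      have h2 := hgX i hi
      rcases dirStep_or ha hij with h | h
      · have h3 := hf' i hi j hj h
        have h4 := hX' i hi j hj h
        left; omega
      · have h3 := hg' i hi j hj h
        have h4 := hY' i hi j hj h
        right; omega)
    (fun i hi => by have := hfY i hi; omega)
    (fun i hi => by have := hgX i hi; omega) r
  refine ⟨_, Finset.filter_subset _ _, hcard, ?_⟩
  rcases (S.filter fun i => P ≤ B - X i ∧ Q ≤ A - Y i).eq_empty_or_nonempty with he | ⟨i₀, hi₀⟩
  · exact Or.inl he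
  · right
    rw [Finset.mem_filter] at hi₀
    have h1 := hfY i₀ hi₀.1
    have h2 := hgX i₀ hi₀.1
    refine ⟨B - P, A - Q, by omega, ?_, ?_⟩
    · intro l hl hm
      cases l with
      | nil => simp
      | cons i t =>
        have hi := Finset.mem_filter.1 (hl i (by simp))
        have := hXmax i hi.1 t
          (fun x hx => (Finset.mem_filter.1 (hl x (by simp [hx]))).1) hm
        have := hgX i hi.1
        simp only [List.length_cons]
        omega
    · intro l hl hm
      cases l with
      | nil => simp
      | cons i t =>
        have hi := Finset.mem_filter.1 (hl i (by simp))
        have := hYmax i hi.1 t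
          (fun x hx => (Finset.mem_filter.1 (hl x (by simp [hx]))).1) hm
        have := hfY i hi.1
        simp only [List.length_cons]
        omega

end Lengths

theorem exists_card_le (k : ℕ) : ∃ c : ℝ, 0 ≤ c ∧
    ∀ (n : ℕ) (a : Fin n → ℤ), Function.Injective a → ∀ (S : Finset (Fin n)) (A B : ℕ),
      (∀ l, (∀ x ∈ l, x ∈ S) → IsModal a k true l → l.length ≤ A) →
      (∀ l, (∀ x ∈ l, x ∈ S) → IsModal a k false l → l.length ≤ B) →
      (S.card : ℝ) ≤ ((A : ℝ) + B) ^ 2 / (4 * (2 * k + 1)) + c * ((A : ℝ) + B + 1) := by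
  induction k with
  | zero =>
    refine ⟨0, le_rfl, fun n a ha S A B hA hB => ?_⟩
    have h : (S.card : ℝ) ≤ A * B := by exact_mod_cast card_le_of_length_le ha hA hB
    norm_num
    nlinarith [sq_nonneg ((A : ℝ) - B)]
  | succ k ih =>
    obtain ⟨c, hc, ih⟩ := ih
    refine ⟨c + 16, by positivity, fun n a ha S A B hA hB => ?_⟩
    set r : ℕ := (A + B) / (2 * (2 * (k + 1) + 1)) with hr
    obtain ⟨T, -, hcard, hT⟩ := exists_reduced_subset ha hA hB r
    have hcard' : (S.card : ℝ) ≤ 2 * (r : ℝ) ^ 2 + 7 * r + 2 + T.card := by exact_mod_cast hcard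
    set N : ℝ := (A : ℝ) + B with hN
    set K : ℝ := 2 * (k : ℝ) + 1 with hK
    have hK1 : 1 ≤ K := by rw [hK]; linarith [(Nat.cast_nonneg k : (0 : ℝ) ≤ k)]
    have hN0 : 0 ≤ N := by positivity
    set ρ : ℝ := N / (2 * (K + 2)) with hρ
    have hNρ : N = 2 * (K + 2) * ρ := by rw [hρ]; field_simp
    have hr1 : (r : ℝ) ≤ ρ := by
      have := Nat.cast_div_le (α := ℝ) (m := A + B) (n := 2 * (2 * (k + 1) + 1))
      rw [← hr] at this
      refine this.trans_eq ?_
      rw [hρ, hN, hK]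
      push_cast
      ring
    have hr2 : ρ < r + 1 := by
      rw [hρ, div_lt_iff₀ (by positivity)]
      have := Nat.lt_mul_div_succ (A + B) (show 0 < 2 * (2 * (k + 1) + 1) by omega)
      rw [← hr] at this
      have h' : ((A + B : ℕ) : ℝ) < ((2 * (2 * (k + 1) + 1) * (r + 1) : ℕ) : ℝ) := by
        exact_mod_cast this
      push_cast at h'
      rw [hN, hK]
      linarith
    have hr0 : (0 : ℝ) ≤ r := Nat.cast_nonneg r
    have hTle : (T.card : ℝ) ≤ K * ρ ^ 2 + 4 * ρ + 4 + c * (N + 1) := by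
      rcases hT with rfl | ⟨A', B', hAB, hA', hB'⟩
      · simp only [Finset.card_empty, Nat.cast_zero]
        have : 0 ≤ ρ := hr0.trans hr1
        positivity
      · have h1 := ih n a ha T A' B' hA' hB'
        have h2 : (A' : ℝ) + B' = N - 4 * r := by
          have : ((A' + B' + 4 * r : ℕ) : ℝ) = ((A + B : ℕ) : ℝ) := by exact_mod_cast hAB
          push_cast at this
          linarith
        rw [h2] at h1
        have h3 : (N - 4 * r) ^ 2 / (4 * K) ≤ K * ρ ^ 2 + 4 * ρ + 4 := by
          rw [div_le_iff₀ (by positivity)]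
          have e : N - 4 * r = 2 * K * ρ + 4 * (ρ - r) := by rw [hNρ]; ring
          have u0 : 0 ≤ ρ - r := by linarith
          have u1 : ρ - r ≤ 1 := by linarith
          have u2 : (ρ - r) ^ 2 ≤ 1 := by nlinarith
          have u3 : 0 ≤ K * ρ := mul_nonneg (by linarith) (by linarith)
          have u4 : K * ρ * (ρ - r) ≤ K * ρ := mul_le_of_le_one_right u3 u1
          rw [e]
          nlinarith
        have h4 : c * (N - 4 * r + 1) ≤ c * (N + 1) :=
          mul_le_mul_of_nonneg_left (by linarith) hc
        linarith
    have hmain : N ^ 2 / (4 * (2 * ((k + 1 : ℕ) : ℝ) + 1)) = (K + 2) * ρ ^ 2 := by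
      have : 2 * ((k + 1 : ℕ) : ℝ) + 1 = K + 2 := by rw [hK]; push_cast; ring
      rw [this, hρ]
      field_simp
      ring
    rw [hmain]
    have hsq : (r : ℝ) ^ 2 ≤ ρ ^ 2 := pow_le_pow_left₀ hr0 hr1 2
    have hρN : ρ ≤ N := by
      rw [hNρ]
      have : 0 ≤ ρ := hr0.trans hr1
      nlinarith
    nlinarith

/-- For every integer `k ≥ 0` there is a constant `C ≥ 0` such that every permutation of `[n]`
contains a `k`-modal subsequence (increasing-first or decreasing-first) of length `L` with
`(L : ℝ) ≥ √((2k+1)n) - C`. -/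
theorem stmt11 (k : ℕ) :
    ∃ C : ℝ, 0 ≤ C ∧ ∀ (n : ℕ) (a : Fin n → ℤ), IsPermOn n a →
      ∃ (L : ℕ) (s : Fin L → Fin n), StrictMono s ∧
        (IncFirstModal k (a ∘ s) ∨ DecFirstModal k (a ∘ s)) ∧
        (L : ℝ) ≥ Real.sqrt ((2 * k + 1) * n) - C := by
  obtain ⟨c, hc, hcard⟩ := exists_card_le k
  set K : ℝ := 2 * (k : ℝ) + 1 with hK
  have hK1 : 1 ≤ K := by rw [hK]; linarith [(Nat.cast_nonneg k : (0 : ℝ) ≤ k)]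
  refine ⟨K * c + 1, by positivity, fun n a ha => ?_⟩
  classical
  set p : ℕ → Prop := fun m => ∃ d l, IsModal a k d l ∧ l.length = m with hp
  have hbound : ∀ d l, IsModal a k d l → l.length ≤ n := by
    intro d l hl
    have hnd : l.Nodup := (List.sortedLT_iff_isChain.2 hl.isChain_lt).nodup
    simpa using hnd.length_le_card
  obtain ⟨d, l, hl, hlen⟩ : p (Nat.findGreatest p n) :=
    Nat.findGreatest_spec (m := 0) (Nat.zero_le _) ⟨true, [], IsModal.nil k true, rfl⟩
  have hmax : ∀ d' l', IsModal a k d' l' → l'.length ≤ l.length := by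
    intro d' l' hl'
    rw [hlen]
    exact Nat.le_findGreatest (hbound d' l' hl') ⟨d', l', hl', rfl⟩
  obtain ⟨s, hs, hmodal⟩ := hl.exists_subsequence
  refine ⟨l.length, s, hs, hmodal, ?_⟩
  have h := hcard n a ha.1 Finset.univ l.length l.length
    (fun l' _ hl' => hmax true l' hl') (fun l' _ hl' => hmax false l' hl')
  rw [Finset.card_univ, Fintype.card_fin] at h
  set L : ℝ := (l.length : ℝ) with hL
  have hL0 : 0 ≤ L := Nat.cast_nonneg _
  have h1 : K * n ≤ L ^ 2 + K * c * (2 * L + 1) := by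
    have h2 := mul_le_mul_of_nonneg_left h (by linarith : (0 : ℝ) ≤ K)
    have h3 : K * ((L + L) ^ 2 / (4 * K) + c * (L + L + 1)) = L ^ 2 + K * c * (2 * L + 1) := by
      field_simp
      ring
    linarith
  have hKc : 0 ≤ K * c := mul_nonneg (by linarith) hc
  have h4 : Real.sqrt (K * n) ≤ L + (K * c + 1) := by
    apply Real.sqrt_le_iff.2
    exact ⟨by linarith, by nlinarith⟩
  linarith
end
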